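/- arXiv:1808.06157 — 5 statements merged into one kernel-verified Lean document; each statement's English description precedes it below -/
import Mathlib

section
/- Let n ≥ 3 and q ≥ 2 be integers. Then for every function f : G → ℝ, Σ_{x ∈ G} f(x)² ≤ (14/(2·C(n,2)²)) · Σ_{x ∈ G} Σ_{1≤i<j≤n} Σ_{1≤k<l≤n} Σ_{σ ∈ {+1,−1}} (f(x) + f(x + σ·A_{i,j,k,l}))², where C(n,2) = n(n−1)/2. -/
/-- The matrix `A_{i,j,k,l}` (1-based indices). -/
def DGmat (n q : ℕ) (i j k l : ℕ) : Matrix (Fin n) (Fin n) (ZMod q) :=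
  Matrix.of fun a b =>
    (if (a : ℕ) + 1 = i ∧ (b : ℕ) + 1 = k then (1 : ZMod q) else 0)
  + (if (a : ℕ) + 1 = j ∧ (b : ℕ) + 1 = l then 1 else 0)
  - (if (a : ℕ) + 1 = i ∧ (b : ℕ) + 1 = l then 1 else 0)
  - (if (a : ℕ) + 1 = j ∧ (b : ℕ) + 1 = k then 1 else 0)

/-- The group `G` of `n × n` matrices over `ℤ/qℤ` with all row and column sums zero,
as a `ℤ/qℤ`-submodule of the matrices. -/
def Gmod (n q : ℕ) : Submodule (ZMod q) (Matrix (Fin n) (Fin n) (ZMod q)) where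
  carrier := {y | (∀ i, ∑ j, y i j = 0) ∧ (∀ j, ∑ i, y i j = 0)}
  zero_mem' := ⟨fun i => by simp, fun j => by simp⟩
  add_mem' := by
    intro a b ha hb
    obtain ⟨ha1, ha2⟩ := ha
    obtain ⟨hb1, hb2⟩ := hb
    refine ⟨fun i => ?_, fun j => ?_⟩
    · simp [Matrix.add_apply, Finset.sum_add_distrib, ha1 i, hb1 i]
    · simp [Matrix.add_apply, Finset.sum_add_distrib, ha2 j, hb2 j]
  smul_mem' := by
    intro t a ha
    obtain ⟨ha1, ha2⟩ := ha
    refine ⟨fun i => ?_, fun j => ?_⟩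
    · simp [Matrix.smul_apply, smul_eq_mul, ← Finset.mul_sum, ha1 i]
    · simp [Matrix.smul_apply, smul_eq_mul, ← Finset.mul_sum, ha2 j]

open Finset in
/-- Averaging over triangles: if every triangle in the complete graph on `{1, …, n}` carries
weight at least `c`, then the total edge weight is at least `c / 9` times the number of edges. -/
lemma mul_choose_two_le_of_triangle {n : ℕ} (hn : 3 ≤ n) (e : ℕ → ℕ → ℝ) (c : ℝ) (hc : 0 ≤ c)
    (he : ∀ k l, 0 ≤ e k l) (hsymm : ∀ k l, e k l = e l k)
    (htri : ∀ k ∈ Icc 1 n, ∀ l ∈ Icc 1 n, ∀ m ∈ Icc 1 n, c ≤ e k l + e l m + e k m) :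
    c * (n.choose 2 : ℝ) ≤ 9 * ∑ k ∈ Icc 1 n, ∑ l ∈ Icc (k + 1) n, e k l := by
  set s := Icc 1 n with hs
  have hcard : (#s : ℝ) = n := by simp [hs]
  set g : ℕ → ℕ → ℝ := fun k l => if k = l then 0 else e k l with hg
  set T := ∑ k ∈ s, ∑ l ∈ Icc (k + 1) n, e k l with hT
  have hT' : T = ∑ k ∈ s, ∑ l ∈ s, if k < l then e k l else 0 := by
    refine sum_congr rfl fun k _ => ?_
    rw [← sum_filter]
    refine sum_congr ?_ fun _ _ => rfl
    ext l
    simp only [hs, mem_Icc, mem_filter]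
    omega
  have hgsum : ∑ k ∈ s, ∑ l ∈ s, g k l = 2 * T := by
    have hcomm : T = ∑ k ∈ s, ∑ l ∈ s, if l < k then e l k else 0 := by rw [hT', sum_comm]
    rw [two_mul]
    nth_rewrite 1 [hT']
    rw [hcomm, ← sum_add_distrib]
    refine sum_congr rfl fun k _ => ?_
    rw [← sum_add_distrib]
    refine sum_congr rfl fun l _ => ?_
    rcases lt_trichotomy k l with h | h | h
    · simp [hg, h, h.ne, h.le.not_gt]
    · simp [hg, h]
    · simp [hg, h, h.ne', h.le.not_gt, hsymm k l]
  have hg0 : ∀ k l, 0 ≤ g k l := fun k l => by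
    simp only [hg]; split_ifs <;> simp [he]
  have hcount : ∑ k ∈ s, ∑ l ∈ s, ∑ m ∈ s, (if k ≠ l ∧ l ≠ m ∧ k ≠ m then c else 0)
      = n * (n - 1) * (n - 2) * c := by
    have h1 : ∀ k ∈ s, ∀ l ∈ s, ∑ m ∈ s, (if k ≠ l ∧ l ≠ m ∧ k ≠ m then c else 0)
        = if k = l then 0 else (n - 2) * c := by
      intro k hk l hl
      by_cases hkl : k = l
      · simp [hkl]
      · rw [← sum_filter, sum_const, nsmul_eq_mul, if_neg hkl]
        have : s.filter (fun m => k ≠ l ∧ l ≠ m ∧ k ≠ m) = (s.erase k).erase l := by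
          ext m
          simp only [mem_filter, mem_erase]
          grind
        rw [this, card_erase_of_mem (mem_erase.2 ⟨Ne.symm hkl, hl⟩), card_erase_of_mem hk]
        have : #s = n := by simp [hs]
        rw [this, show n - 1 - 1 = n - 2 by omega, Nat.cast_sub (by omega)]
        norm_num
    have h2 : ∀ k ∈ s, ∑ l ∈ s, (if k = l then 0 else ((n : ℝ) - 2) * c)
        = (n - 1) * ((n - 2) * c) := by
      intro k hk
      have : ∀ l, (if k = l then 0 else ((n : ℝ) - 2) * c)
          = (n - 2) * c - if k = l then (n - 2) * c else 0 := by
        intro l; split_ifs <;> simp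
      simp only [this, sum_sub_distrib, sum_const, nsmul_eq_mul, hcard, sum_ite_eq, hk, if_true]
      ring
    rw [sum_congr rfl fun k hk => (sum_congr rfl (h1 k hk)).trans (h2 k hk), sum_const,
      nsmul_eq_mul, hcard]
    ring
  have hle : ∑ k ∈ s, ∑ l ∈ s, ∑ m ∈ s, (if k ≠ l ∧ l ≠ m ∧ k ≠ m then c else 0)
      ≤ ∑ k ∈ s, ∑ l ∈ s, ∑ m ∈ s, (g k l + g l m + g k m) := by
    refine sum_le_sum fun k hk => sum_le_sum fun l hl => sum_le_sum fun m hm => ?_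
    split_ifs with h
    · simpa [hg, h.1, h.2.1, h.2.2] using htri k hk l hl m hm
    · linarith [hg0 k l, hg0 l m, hg0 k m]
  have hsum : ∑ k ∈ s, ∑ l ∈ s, ∑ m ∈ s, (g k l + g l m + g k m) = n * (6 * T) := by
    simp only [sum_add_distrib, sum_const, nsmul_eq_mul, hcard, ← mul_sum, hgsum]
    ring
  rw [hcount, hsum] at hle
  have hn' : (3 : ℝ) ≤ n := by exact_mod_cast hn
  have h3 : ((n : ℝ) - 1) * (n - 2) * c ≤ 6 * T := by
    refine le_of_mul_le_mul_left ?_ (by linarith : (0 : ℝ) < n)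
    linarith
  rw [Nat.cast_choose_two]
  have h4 : 0 ≤ ((n : ℝ) - 1) * c * (n - 3) :=
    mul_nonneg (mul_nonneg (by linarith) hc) (by linarith)
  nlinarith

open Finset in
lemma sum_sq_triangle_le {V : Type*} [AddCommGroup V] (S : Finset V) (f : V → ℝ) {A B : V}
    (hA : ∀ x, x + A ∈ S ↔ x ∈ S) :
    4 * ∑ x ∈ S, f x ^ 2 ≤ 3 * (∑ x ∈ S, (f x + f (x + A)) ^ 2
      + ∑ x ∈ S, (f x + f (x + B)) ^ 2 + ∑ x ∈ S, (f x + f (x + (A + B))) ^ 2) := by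
  have hshift : ∑ x ∈ S, (f x + f (x + B)) ^ 2
      = ∑ x ∈ S, (f (x + A) + f (x + (A + B))) ^ 2 := by
    symm
    refine sum_equiv (Equiv.addRight A) (fun x => (hA x).symm) fun x _ => ?_
    simp [add_assoc]
  rw [hshift, ← sum_add_distrib, ← sum_add_distrib, mul_sum, mul_sum]
  refine sum_le_sum fun x _ => ?_
  set u := f x
  set v := f (x + A)
  set w := f (x + (A + B))
  nlinarith [sq_nonneg ((u + v) + (v + w)), sq_nonneg ((u + v) - (u + w)),
    sq_nonneg ((v + w) + (u + w))]

lemma DGmat_mem_Gmod {n q i j k l : ℕ} (hi : i ∈ Finset.Icc 1 n) (hj : j ∈ Finset.Icc 1 n)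
    (hk : k ∈ Finset.Icc 1 n) (hl : l ∈ Finset.Icc 1 n) : DGmat n q i j k l ∈ Gmod n q := by
  have key : ∀ (P : Prop) [Decidable P] (m : ℕ), m ∈ Finset.Icc 1 n →
      ∑ b : Fin n, (if P ∧ (b : ℕ) + 1 = m then (1 : ZMod q) else 0) = if P then 1 else 0 := by
    intro P _ m hm
    rw [Finset.mem_Icc] at hm
    have : ∀ b : Fin n, (P ∧ (b : ℕ) + 1 = m) ↔ (P ∧ b = ⟨m - 1, by omega⟩) := by
      intro b
      rw [Fin.ext_iff]
      have : (b : ℕ) + 1 = m ↔ (b : ℕ) = m - 1 := by omega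
      simp [this]
    simp only [this]
    by_cases hP : P <;> simp [hP]
  refine ⟨fun a => ?_, fun b => ?_⟩
  · simp only [DGmat, Matrix.of_apply, Finset.sum_add_distrib, Finset.sum_sub_distrib]
    rw [key _ k hk, key _ l hl, key _ l hl, key _ k hk]
    ring
  · simp only [DGmat, Matrix.of_apply, Finset.sum_add_distrib, Finset.sum_sub_distrib,
      and_comm (b := (b : ℕ) + 1 = _)]
    rw [key _ i hi, key _ j hj, key _ i hi, key _ j hj]
    ring

lemma DGmat_swap (n q i j k l : ℕ) : DGmat n q i j l k = -DGmat n q i j k l := by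
  ext a b
  simp only [DGmat, Matrix.of_apply, Matrix.neg_apply]
  ring

lemma DGmat_add (n q i j k l m : ℕ) :
    DGmat n q i j k l + DGmat n q i j l m = DGmat n q i j k m := by
  ext a b
  simp only [DGmat, Matrix.of_apply, Matrix.add_apply]
  ring

open scoped Classical in
theorem stmt8 (n q : ℕ) [NeZero q] (hn : 3 ≤ n) (hq : 2 ≤ q)
    (f : Matrix (Fin n) (Fin n) (ZMod q) → ℝ) :
    ∑ x ∈ Finset.univ.filter (fun x : Matrix (Fin n) (Fin n) (ZMod q) => x ∈ Gmod n q),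
        f x ^ 2
      ≤ 14 / (2 * (n.choose 2 : ℝ) ^ 2) *
        ∑ x ∈ Finset.univ.filter (fun x : Matrix (Fin n) (Fin n) (ZMod q) => x ∈ Gmod n q),
          ∑ i ∈ Finset.Icc 1 n, ∑ j ∈ Finset.Icc (i + 1) n,
            ∑ k ∈ Finset.Icc 1 n, ∑ l ∈ Finset.Icc (k + 1) n,
              ∑ σ : Bool,
                (f x + f (x + (if σ then DGmat n q i j k l else - DGmat n q i j k l))) ^ 2 := by
  set S := Finset.univ.filter (fun x : Matrix (Fin n) (Fin n) (ZMod q) => x ∈ Gmod n q) with hS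
  set F := ∑ x ∈ S, f x ^ 2 with hF
  have hF0 : 0 ≤ F := Finset.sum_nonneg fun _ _ => sq_nonneg _
  set E : Matrix (Fin n) (Fin n) (ZMod q) → ℝ := fun A => ∑ x ∈ S, (f x + f (x + A)) ^ 2 with hE
  have hE0 : ∀ A, 0 ≤ E A := fun A => Finset.sum_nonneg fun _ _ => sq_nonneg _
  set d : ℕ → ℕ → ℕ → ℕ → ℝ := fun i j k l => E (DGmat n q i j k l) + E (-DGmat n q i j k l) with hd
  have hd0 : ∀ i j k l, 0 ≤ d i j k l := fun i j k l => add_nonneg (hE0 _) (hE0 _)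
  have hshift : ∀ A ∈ Gmod n q, ∀ x, x + A ∈ S ↔ x ∈ S := fun A hA x => by
    simp only [hS, Finset.mem_filter, Finset.mem_univ, true_and]
    exact (Gmod n q).add_mem_iff_left hA
  have htri : ∀ i ∈ Finset.Icc 1 n, ∀ j ∈ Finset.Icc 1 n, ∀ k ∈ Finset.Icc 1 n,
      ∀ l ∈ Finset.Icc 1 n, ∀ m ∈ Finset.Icc 1 n,
      8 * F / 3 ≤ d i j k l + d i j l m + d i j k m := by
    intro i hi j hj k hk l hl m hm
    have hA := DGmat_mem_Gmod (q := q) hi hj hk hl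
    have h1 := sum_sq_triangle_le S f (B := DGmat n q i j l m) (hshift _ hA)
    have h2 := sum_sq_triangle_le S f (B := -DGmat n q i j l m)
      (hshift _ ((Gmod n q).neg_mem hA))
    rw [← neg_add, DGmat_add] at h2
    rw [DGmat_add] at h1
    simp only [hd, hE]
    linarith
  have hrow : ∀ i ∈ Finset.Icc 1 n, ∀ j ∈ Finset.Icc (i + 1) n,
      8 * F / 27 * (n.choose 2 : ℝ)
        ≤ ∑ k ∈ Finset.Icc 1 n, ∑ l ∈ Finset.Icc (k + 1) n, d i j k l := by
    intro i hi j hj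
    have hj' : j ∈ Finset.Icc 1 n := by
      rw [Finset.mem_Icc] at hj ⊢
      omega
    have := mul_choose_two_le_of_triangle hn (d i j) (8 * F / 3) (by positivity) (hd0 i j)
      (fun k l => by simp only [hd, DGmat_swap n q i j l k, neg_neg]; ring)
      (htri i hi j hj')
    linarith
  have hpairs : ∑ i ∈ Finset.Icc 1 n, ∑ j ∈ Finset.Icc (i + 1) n, (8 * F / 27 * (n.choose 2 : ℝ))
      = 8 * F / 27 * (n.choose 2 : ℝ) ^ 2 := by
    have hcard : ∑ i ∈ Finset.Icc 1 n, (n - i) = n.choose 2 := by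
      rw [Nat.choose_two_right, ← Finset.sum_range_id]
      refine Finset.sum_nbij' (fun i => n - i) (fun i => n - i) ?_ ?_ ?_ ?_ fun _ _ => rfl <;>
        simp only [Finset.mem_Icc, Finset.mem_range] <;> intros <;> omega
    simp only [Finset.sum_const, Nat.card_Icc, Nat.add_sub_add_right]
    rw [← Finset.sum_smul, hcard, nsmul_eq_mul]
    ring
  have htotal : ∑ x ∈ S, ∑ i ∈ Finset.Icc 1 n, ∑ j ∈ Finset.Icc (i + 1) n,
      ∑ k ∈ Finset.Icc 1 n, ∑ l ∈ Finset.Icc (k + 1) n, ∑ σ : Bool,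
        (f x + f (x + (if σ then DGmat n q i j k l else - DGmat n q i j k l))) ^ 2
      = ∑ i ∈ Finset.Icc 1 n, ∑ j ∈ Finset.Icc (i + 1) n,
        ∑ k ∈ Finset.Icc 1 n, ∑ l ∈ Finset.Icc (k + 1) n, d i j k l := by
    rw [Finset.sum_comm]
    refine Finset.sum_congr rfl fun i _ => ?_
    rw [Finset.sum_comm]
    refine Finset.sum_congr rfl fun j _ => ?_
    rw [Finset.sum_comm]
    refine Finset.sum_congr rfl fun k _ => ?_
    rw [Finset.sum_comm]
    refine Finset.sum_congr rfl fun l _ => ?_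
    simp [hd, hE, Finset.sum_add_distrib]
  have hlower := Finset.sum_le_sum fun i hi => Finset.sum_le_sum (hrow i hi)
  rw [hpairs] at hlower
  rw [htotal]
  have hC : (0 : ℝ) < n.choose 2 := by exact_mod_cast Nat.choose_pos (by omega)
  rw [div_mul_eq_mul_div, le_div_iff₀ (by positivity)]
  nlinarith [mul_nonneg hF0 (sq_nonneg (n.choose 2 : ℝ))]
end

section
/- Let n ≥ 2 and q ≥ 2 be integers, and let a, b be integers with 1 ≤ a, b ≤ ⌊(n−1)/2⌋. Then for every (n−1)×(n−1) matrix x over ℤ/qℤ, (1/(2·C(n,2)²))·Σ_{1≤i≤j≤n−1} Σ_{1≤k≤l≤n−1} Σ_{σ ∈ {+1,−1}} cos(2π⟨x + σ·Ã_{i,j,k,l}, D_{a,b}⟩/q) = (1 − 4/n² + (4/n²)·cos(2π/q)) · cos(2π⟨x, D_{a,b}⟩/q), where C(n,2) = n(n−1)/2. -/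
/-- The matrix `Ã_{i,j,k,l}` (1-based indices): entry 1 at `(a,c)` iff
`i ≤ a ≤ j` and `k ≤ c ≤ l`. -/
def Atil (n q : ℕ) (i j k l : ℕ) : Matrix (Fin (n - 1)) (Fin (n - 1)) (ZMod q) :=
  Matrix.of fun a c =>
    if (i ≤ (a : ℕ) + 1 ∧ (a : ℕ) + 1 ≤ j) ∧ (k ≤ (c : ℕ) + 1 ∧ (c : ℕ) + 1 ≤ l)
      then (1 : ZMod q) else 0

/-- Inner product `⟨y, z⟩ = Σ_{a,c} y(a,c)·z(a,c)` in `ℤ/qℤ`. -/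
def inner2 {m q : ℕ} (y z : Matrix (Fin m) (Fin m) (ZMod q)) : ZMod q :=
  ∑ a, ∑ c, y a c * z a c

/-- `cos(2πa/q)` for `a ∈ ℤ/qℤ`. -/
noncomputable def zcos (q : ℕ) (a : ZMod q) : ℝ :=
  Real.cos (2 * Real.pi * (a.val : ℝ) / q)


/-- The matrix `D_{a,b}` (1-based indices): entry 1 at `(2a-1,2b-1)` and `(2a,2b)`,
entry `-1` at `(2a,2b-1)` and `(2a-1,2b)`. -/
def Dmat (n q : ℕ) (a b : ℕ) : Matrix (Fin (n - 1)) (Fin (n - 1)) (ZMod q) :=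
  Matrix.of fun s t =>
    (if (s : ℕ) + 1 = 2 * a - 1 ∧ (t : ℕ) + 1 = 2 * b - 1 then (1 : ZMod q) else 0)
  + (if (s : ℕ) + 1 = 2 * a ∧ (t : ℕ) + 1 = 2 * b then 1 else 0)
  - (if (s : ℕ) + 1 = 2 * a ∧ (t : ℕ) + 1 = 2 * b - 1 then 1 else 0)
  - (if (s : ℕ) + 1 = 2 * a - 1 ∧ (t : ℕ) + 1 = 2 * b then 1 else 0)

lemma zcos_intCast (q : ℕ) (hq : 2 ≤ q) (z : ℤ) :
    zcos q (z : ZMod q) = Real.cos (2 * Real.pi * z / q) := by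
  have : NeZero q := ⟨by omega⟩
  have hq0 : (q : ℝ) ≠ 0 := by exact_mod_cast (by omega : q ≠ 0)
  have h : (((z : ZMod q).val : ℤ) : ZMod q) = (z : ZMod q) := by simp
  rw [ZMod.intCast_eq_intCast_iff_dvd_sub] at h
  obtain ⟨k, hk⟩ := h
  have hz : (z : ℝ) = ((z : ZMod q).val : ℝ) + q * k := by
    have : z = ((z : ZMod q).val : ℤ) + q * k := by linarith
    exact_mod_cast this
  have e : 2 * Real.pi * (z : ℝ) / q
      = 2 * Real.pi * ((z : ZMod q).val : ℝ) / q + k * (2 * Real.pi) := by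
    rw [hz]; field_simp
  rw [e, Real.cos_add_int_mul_two_pi, zcos]

lemma zcos_add_add_zcos_sub (q : ℕ) (hq : 2 ≤ q) (y : ZMod q) (z : ℤ) :
    zcos q (y + z) + zcos q (y - z) = 2 * Real.cos (2 * Real.pi * z / q) * zcos q y := by
  obtain ⟨w, rfl⟩ := ZMod.intCast_surjective y
  rw [← Int.cast_add, ← Int.cast_sub, zcos_intCast q hq, zcos_intCast q hq, zcos_intCast q hq]
  have h1 : 2 * Real.pi * ((w + z : ℤ) : ℝ) / q
      = 2 * Real.pi * w / q + 2 * Real.pi * z / q := by push_cast; ring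
  have h2 : 2 * Real.pi * ((w - z : ℤ) : ℝ) / q
      = 2 * Real.pi * w / q - 2 * Real.pi * z / q := by push_cast; ring
  rw [h1, h2, Real.cos_add, Real.cos_sub]; ring

/-- The drop, from `p` to `p + 1`, of the indicator function of the interval `[i, j]`. -/
def intervalDrop (p i j : ℕ) : ℤ :=
  (if i ≤ p ∧ p ≤ j then 1 else 0) - (if i ≤ p + 1 ∧ p + 1 ≤ j then 1 else 0)

lemma intervalDrop_sq {p i j : ℕ} (hij : i ≤ j) :
    (intervalDrop p i j : ℝ) ^ 2
      = (if p = j then 1 else 0) + (if i = p + 1 then 1 else 0) := by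
  unfold intervalDrop
  split_ifs <;> first | omega | norm_num

lemma sum_intervalDrop_sq {p m : ℕ} (hp : p + 1 ≤ m) :
    ∑ i ∈ Finset.Icc 1 m, ∑ j ∈ Finset.Icc i m, (intervalDrop p i j : ℝ) ^ 2 = m := by
  have inner : ∀ i ∈ Finset.Icc 1 m, ∑ j ∈ Finset.Icc i m, (intervalDrop p i j : ℝ) ^ 2
      = (if i ≤ p then 1 else 0) + (if i = p + 1 then ((m - p : ℕ) : ℝ) else 0) := by
    intro i _
    rw [Finset.sum_congr rfl fun j hj => intervalDrop_sq (Finset.mem_Icc.1 hj).1,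
      Finset.sum_add_distrib, Finset.sum_ite_eq, Finset.sum_const, Nat.card_Icc]
    congr 1
    · exact if_congr (by rw [Finset.mem_Icc]; omega) rfl rfl
    · split_ifs with h
      · rw [h, nsmul_eq_mul, mul_one]; congr 1; omega
      · simp
  rw [Finset.sum_congr rfl inner, Finset.sum_add_distrib, Finset.sum_ite_eq',
    if_pos (by rw [Finset.mem_Icc]; omega), ← Finset.sum_filter, Finset.sum_const]
  have : (Finset.Icc 1 m).filter (· ≤ p) = Finset.Icc 1 p := by
    ext i; simp only [Finset.mem_filter, Finset.mem_Icc]; omega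
  rw [this, Nat.card_Icc, Nat.add_sub_cancel, nsmul_eq_mul, mul_one,
    Nat.cast_sub (by omega)]
  ring

lemma sum_intervals_const (m : ℕ) (c : ℝ) :
    ∑ i ∈ Finset.Icc 1 m, ∑ _j ∈ Finset.Icc i m, c = (m + 1) * m / 2 * c := by
  induction m with
  | zero => simp
  | succ m ih =>
    rw [Finset.sum_Icc_succ_top (by omega)]
    have : ∀ i ∈ Finset.Icc 1 m, ∑ _j ∈ Finset.Icc i (m + 1), c
        = ∑ _j ∈ Finset.Icc i m, c + c := fun i hi => by
      rw [Finset.sum_Icc_succ_top (by have := (Finset.mem_Icc.1 hi).2; omega)]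
    rw [Finset.sum_congr rfl this, Finset.sum_add_distrib, ih]
    simp
    ring

lemma intervalDrop_eq_zero_or_one_or_neg_one (p i j : ℕ) :
    intervalDrop p i j = 0 ∨ intervalDrop p i j = 1 ∨ intervalDrop p i j = -1 := by
  unfold intervalDrop
  split_ifs <;> simp

lemma cos_mul_intervalDrop_mul (t : ℝ) (q p i j r k l : ℕ) :
    Real.cos (t * ((intervalDrop p i j * intervalDrop r k l : ℤ) : ℝ) / q)
      = 1 - (intervalDrop p i j : ℝ) ^ 2 * (intervalDrop r k l : ℝ) ^ 2
          * (1 - Real.cos (t / q)) := by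
  rcases intervalDrop_eq_zero_or_one_or_neg_one p i j with h | h | h <;>
    rcases intervalDrop_eq_zero_or_one_or_neg_one r k l with h' | h' | h' <;>
    simp [h, h', neg_div]

lemma sum_mul_drop {m q : ℕ} (p i j : ℕ) (hp : 1 ≤ p) (hm : p + 1 ≤ m) :
    ∑ s : Fin m, (if i ≤ (s : ℕ) + 1 ∧ (s : ℕ) + 1 ≤ j then (1 : ZMod q) else 0)
        * ((if (s : ℕ) + 1 = p then 1 else 0) - (if (s : ℕ) + 1 = p + 1 then 1 else 0))
      = (intervalDrop p i j : ZMod q) := by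
  have h1 : ∀ s : Fin m, (s : ℕ) + 1 = p ↔ s = ⟨p - 1, by omega⟩ := fun s => by
    rw [Fin.ext_iff]; simp only; omega
  have h2 : ∀ s : Fin m, (s : ℕ) + 1 = p + 1 ↔ s = ⟨p, by omega⟩ := fun s => by
    rw [Fin.ext_iff]; simp only; omega
  simp only [mul_sub, Finset.sum_sub_distrib, h1, h2, mul_ite, mul_one, mul_zero,
    Finset.sum_ite_eq', Finset.mem_univ, if_true, intervalDrop, Nat.sub_add_cancel hp]
  push_cast
  rfl

lemma inner2_Atil_Dmat (n q a b i j k l : ℕ) (ha1 : 1 ≤ a) (ha2 : a ≤ (n - 1) / 2)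
    (hb1 : 1 ≤ b) (hb2 : b ≤ (n - 1) / 2) :
    inner2 (Atil n q i j k l) (Dmat n q a b)
      = ((intervalDrop (2 * a - 1) i j * intervalDrop (2 * b - 1) k l : ℤ) : ZMod q) := by
  rw [Int.cast_mul, ← sum_mul_drop (m := n - 1) (2 * a - 1) i j (by omega) (by omega),
    ← sum_mul_drop (m := n - 1) (2 * b - 1) k l (by omega) (by omega), Finset.sum_mul_sum]
  rw [inner2]
  refine Finset.sum_congr rfl fun s _ => Finset.sum_congr rfl fun t _ => ?_
  rw [show 2 * a - 1 + 1 = 2 * a by omega, show 2 * b - 1 + 1 = 2 * b by omega]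
  simp only [Atil, Dmat, Matrix.of_apply, ite_and]
  split_ifs <;> ring

lemma inner2_add_left {m q : ℕ} (x y z : Matrix (Fin m) (Fin m) (ZMod q)) :
    inner2 (x + y) z = inner2 x z + inner2 y z := by
  simp [inner2, add_mul, Finset.sum_add_distrib]

lemma inner2_neg_left {m q : ℕ} (y z : Matrix (Fin m) (Fin m) (ZMod q)) :
    inner2 (-y) z = -inner2 y z := by
  simp [inner2]

theorem stmt9 (n q : ℕ) (hn : 2 ≤ n) (hq : 2 ≤ q) (a b : ℕ)
    (ha1 : 1 ≤ a) (ha2 : a ≤ (n - 1) / 2) (hb1 : 1 ≤ b) (hb2 : b ≤ (n - 1) / 2)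
    (x : Matrix (Fin (n - 1)) (Fin (n - 1)) (ZMod q)) :
    1 / (2 * (n.choose 2 : ℝ) ^ 2) *
      ∑ i ∈ Finset.Icc 1 (n - 1), ∑ j ∈ Finset.Icc i (n - 1),
        ∑ k ∈ Finset.Icc 1 (n - 1), ∑ l ∈ Finset.Icc k (n - 1),
          ∑ σ : Bool,
            zcos q (inner2 (x + (if σ then Atil n q i j k l else - Atil n q i j k l))
              (Dmat n q a b))
      = (1 - 4 / (n : ℝ) ^ 2 + 4 / (n : ℝ) ^ 2 * Real.cos (2 * Real.pi / q)) *
          zcos q (inner2 x (Dmat n q a b)) := by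
  have step : ∀ i j k l : ℕ, ∑ σ : Bool,
      zcos q (inner2 (x + (if σ then Atil n q i j k l else - Atil n q i j k l))
        (Dmat n q a b))
      = 2 * zcos q (inner2 x (Dmat n q a b)) * 1
        - 2 * zcos q (inner2 x (Dmat n q a b)) * (1 - Real.cos (2 * Real.pi / q))
          * ((intervalDrop (2 * a - 1) i j : ℝ) ^ 2
            * (intervalDrop (2 * b - 1) k l : ℝ) ^ 2) := by
    intro i j k l
    rw [Fintype.sum_bool, if_pos rfl, if_neg Bool.false_ne_true, inner2_add_left, inner2_add_left,
      inner2_neg_left, inner2_Atil_Dmat n q a b i j k l ha1 ha2 hb1 hb2, ← sub_eq_add_neg,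
      zcos_add_add_zcos_sub q hq, cos_mul_intervalDrop_mul]
    ring
  simp only [step, Finset.sum_sub_distrib, ← Finset.mul_sum, ← Finset.sum_mul]
  rw [sum_intervalDrop_sq (by omega), sum_intervalDrop_sq (by omega), sum_intervals_const,
    sum_intervals_const,
    Nat.cast_choose_two, Nat.cast_sub (by omega : 1 ≤ n)]
  have h0 : (n : ℝ) ≠ 0 := by exact_mod_cast (by omega : n ≠ 0)
  have h1 : (n : ℝ) - 1 ≠ 0 := by
    rw [sub_ne_zero]; exact_mod_cast (by omega : n ≠ 1)
  push_cast
  field_simp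
  ring
end

section
/- Let n ≥ 3 and q ≥ 2 be integers, and let u ∈ (ℤ/qℤ)^{n−1}. Suppose i_1 < i_2 < ⋯ < i_s are indices in {1,…,n−1} such that u_{i_m} ≠ 0 for every 1 ≤ m ≤ s and i_{m+1} ≥ i_m + 2 for every 1 ≤ m ≤ s−1. Then S(u) ≥ s·(n − s). -/
/-- `Σ_{h=i}^{j} u_h` (1-based indices) for a vector `u`. -/
def isum {m q : ℕ} (u : Fin m → ZMod q) (i j : ℕ) : ZMod q :=
  ∑ a ∈ Finset.univ.filter (fun a : Fin m => i ≤ (a : ℕ) + 1 ∧ (a : ℕ) + 1 ≤ j), u a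

/-- `S(u)`: the number of nonzero intervals of `u` (1-based intervals `[i,j] ⊆ [1,m]`). -/
def nzIntervals {m q : ℕ} (u : Fin m → ZMod q) : ℕ :=
  ((Finset.Icc 1 m ×ˢ Finset.Icc 1 m).filter
    (fun p => p.1 ≤ p.2 ∧ isum u p.1 p.2 ≠ 0)).card

/-- The sum of the entries of `y` over the box `[i,j] × [k,l]` (1-based indices). -/
def bsum {m q : ℕ} (y : Matrix (Fin m) (Fin m) (ZMod q)) (i j k l : ℕ) : ZMod q :=
  ∑ a ∈ Finset.univ.filter (fun a : Fin m => i ≤ (a : ℕ) + 1 ∧ (a : ℕ) + 1 ≤ j),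
    ∑ c ∈ Finset.univ.filter (fun c : Fin m => k ≤ (c : ℕ) + 1 ∧ (c : ℕ) + 1 ≤ l), y a c

/-- `N(y)`: the number of nonzero boxes of `y`. -/
def Nboxes {m q : ℕ} (y : Matrix (Fin m) (Fin m) (ZMod q)) : ℕ :=
  (((Finset.Icc 1 m ×ˢ Finset.Icc 1 m) ×ˢ (Finset.Icc 1 m ×ˢ Finset.Icc 1 m)).filter
    (fun p => p.1.1 ≤ p.1.2 ∧ p.2.1 ≤ p.2.2 ∧ bsum y p.1.1 p.1.2 p.2.1 p.2.2 ≠ 0)).card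

open Finset in
/-- A colouring of `V` with `k` disjoint bichromatic pairs `(a i, b i)` has at least
`2 k (|V| - k)` ordered bichromatic pairs. -/
theorem two_mul_le_card_bichromatic {V α ι : Type*} [Fintype V] [DecidableEq V] [DecidableEq α]
    [Fintype ι] (c : V → α) (a b : ι → V) (ha : Function.Injective a)
    (hb : Function.Injective b) (hab : ∀ i j, a i ≠ b j) (hc : ∀ i, c (a i) ≠ c (b i)) :
    2 * ((Fintype.card ι : ℤ) * (Fintype.card V - Fintype.card ι)) ≤
      #{p : V × V | c p.1 ≠ c p.2} := by
  let d : V → ℕ := fun v => #{w : V | c v ≠ c w}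
  have hsum : #{p : V × V | c p.1 ≠ c p.2} = ∑ v, d v := by
    simp only [d, card_filter, Fintype.sum_prod_type]
  have hd : ∀ v, Fintype.card ι ≤ d v := by
    intro v
    let g : ι → V := fun i => if c v = c (a i) then b i else a i
    have hg : Function.Injective g := by
      intro i j hij
      simp only [g] at hij
      split_ifs at hij
      · exact hb hij
      · exact absurd hij.symm (hab _ _)
      · exact absurd hij (hab _ _)
      · exact ha hij
    rw [← card_univ, ← card_image_of_injective univ hg]
    refine card_le_card ?_
    intro w hw
    obtain ⟨i, -, rfl⟩ := mem_image.1 hw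
    simp only [g, mem_filter, mem_univ, true_and]
    split_ifs with h
    · exact fun h' => hc i (h.symm.trans h')
    · exact h
  have hpair : ∀ i, Fintype.card V ≤ d (a i) + d (b i) := by
    intro i
    rw [← card_univ]
    refine le_trans (card_le_card ?_) (card_union_le _ _)
    intro w _
    simp only [mem_union, mem_filter, mem_univ, true_and]
    by_contra! h
    exact hc i (h.1.trans h.2.symm)
  let A := univ.image a
  let B := univ.image b
  have hdisj : Disjoint A B := by
    rw [disjoint_left]
    intro v hv hv'
    obtain ⟨i, -, rfl⟩ := mem_image.1 hv
    obtain ⟨j, -, hj⟩ := mem_image.1 hv'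
    exact hab i j hj.symm
  have hcard : #(A ∪ B) = 2 * Fintype.card ι := by
    rw [card_union_of_disjoint hdisj, card_image_of_injective _ ha,
      card_image_of_injective _ hb, card_univ, two_mul]
  have hcompl : #(A ∪ B) + #(A ∪ B)ᶜ = Fintype.card V := card_add_card_compl _
  have h₁ : Fintype.card ι * Fintype.card V ≤ ∑ v ∈ A ∪ B, d v := by
    rw [sum_union hdisj, sum_image ha.injOn, sum_image hb.injOn, ← sum_add_distrib]
    simpa using card_nsmul_le_sum univ _ _ fun i _ => hpair i
  have h₂ : #(A ∪ B)ᶜ * Fintype.card ι ≤ ∑ v ∈ (A ∪ B)ᶜ, d v := by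
    simpa using card_nsmul_le_sum (A ∪ B)ᶜ d _ fun v _ => hd v
  have h₃ := sum_add_sum_compl (A ∪ B) d
  rw [hsum, ← h₃]
  rw [hcard] at hcompl
  zify at h₁ h₂ hcompl
  push_cast
  rw [← hcompl] at h₁ ⊢
  linarith

open Finset in
/-- Each unordered bichromatic pair is counted twice among the ordered ones. -/
theorem card_bichromatic_eq_two_mul {V α : Type*} [Fintype V] [LinearOrder V] [DecidableEq α]
    (c : V → α) :
    #{p : V × V | c p.1 ≠ c p.2} = 2 * #{p : V × V | p.1 < p.2 ∧ c p.1 ≠ c p.2} := by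
  have hswap : #{p : V × V | p.1 < p.2 ∧ c p.1 ≠ c p.2} =
      #{p : V × V | p.2 < p.1 ∧ c p.1 ≠ c p.2} := by
    refine card_bij (fun p _ => p.swap) ?_ ?_ ?_
    · simp +contextual [eq_comm]
    · intro p _ p' _ h
      exact Prod.swap_injective h
    · intro p hp
      refine ⟨p.swap, ?_, p.swap_swap⟩
      simpa [eq_comm] using hp
  rw [two_mul]
  nth_rw 2 [hswap]
  rw [← card_union_of_disjoint]
  · congr 1
    ext p
    simp only [mem_filter, mem_univ, true_and, mem_union]
    constructor
    · intro h
      rcases lt_or_gt_of_ne (fun e : p.1 = p.2 => h (congrArg c e)) with h' | h'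
      · exact Or.inl ⟨h', h⟩
      · exact Or.inr ⟨h', h⟩
    · rintro (h | h) <;> exact h.2
  · rw [disjoint_filter]
    exact fun p _ h h' => lt_asymm h.1 h'.1

theorem isum_one_add_isum {m q : ℕ} (u : Fin m → ZMod q) {i j : ℕ} (hij : i ≤ j) :
    isum u 1 i + isum u (i + 1) j = isum u 1 j := by
  unfold isum
  rw [← Finset.sum_union]
  · congr 1
    ext a
    simp only [Finset.mem_union, Finset.mem_filter, Finset.mem_univ, true_and]
    omega
  · rw [Finset.disjoint_filter]
    intro a _ h
    omega

theorem isum_ne_zero_iff {m q : ℕ} (u : Fin m → ZMod q) {i j : ℕ} (hij : i ≤ j) :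
    isum u (i + 1) j ≠ 0 ↔ isum u 1 i ≠ isum u 1 j := by
  rw [← isum_one_add_isum u hij]
  simp

/-- Nonzero intervals correspond to pairs of distinct partial sums. -/
theorem card_partial_sums_ne_le_nzIntervals {m q : ℕ} (u : Fin m → ZMod q) :
    (Finset.univ.filter fun p : Fin (m + 1) × Fin (m + 1) =>
      p.1 < p.2 ∧ isum u 1 p.1 ≠ isum u 1 p.2).card ≤ nzIntervals u := by
  refine Finset.card_le_card_of_injOn (fun p => ((p.1 : ℕ) + 1, (p.2 : ℕ))) ?_ ?_
  · rintro ⟨i, j⟩ h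
    simp only [Finset.coe_filter, Finset.mem_univ, true_and, Set.mem_ofPred_eq, Fin.lt_def] at h
    simp only [Finset.coe_filter, Finset.mem_product, Finset.mem_Icc, Set.mem_ofPred_eq]
    refine ⟨by omega, by omega, (isum_ne_zero_iff u h.1.le).2 h.2⟩
  · rintro ⟨i, j⟩ _ ⟨i', j'⟩ _ h
    simp only [Prod.mk.injEq] at h
    ext <;> simp <;> omega

theorem add_two_le_of_lt_of_gap {s : ℕ} {idx : Fin s → ℕ} (hmono : StrictMono idx)
    (hgap : ∀ m : Fin s, ∀ hm : (m : ℕ) + 1 < s, idx m + 2 ≤ idx ⟨(m : ℕ) + 1, hm⟩)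
    {i j : Fin s} (hij : i < j) : idx i + 2 ≤ idx j := by
  have hi : (i : ℕ) + 1 < s := lt_of_le_of_lt (Fin.lt_def.1 hij) j.isLt
  exact (hgap i hi).trans (hmono.monotone (Fin.le_def.2 (Fin.lt_def.1 hij)))

theorem stmt11 (n q : ℕ) (hn : 3 ≤ n) (hq : 2 ≤ q)
    (u : Fin (n - 1) → ZMod q) (s : ℕ) (idx : Fin s → ℕ)
    (hmono : StrictMono idx)
    (hgap : ∀ m : Fin s, ∀ hm : (m : ℕ) + 1 < s, idx m + 2 ≤ idx ⟨(m : ℕ) + 1, hm⟩)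
    (hlo : ∀ m, 1 ≤ idx m) (hhi : ∀ m, idx m ≤ n - 1)
    (hnz : ∀ m, isum u (idx m) (idx m) ≠ 0) :
    (s : ℤ) * ((n : ℤ) - s) ≤ (nzIntervals u : ℤ) := by
  let c : Fin (n - 1 + 1) → ZMod q := fun v => isum u 1 v
  let a : Fin s → Fin (n - 1 + 1) := fun m => ⟨idx m - 1, by have := hhi m; omega⟩
  let b : Fin s → Fin (n - 1 + 1) := fun m => ⟨idx m, by have := hhi m; omega⟩
  have hb : Function.Injective b := fun i j h => hmono.injective (Fin.mk.inj h)
  have ha : Function.Injective a := by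
    intro i j h
    have h' : idx i - 1 = idx j - 1 := Fin.mk.inj h
    have hi := hlo i
    have hj := hlo j
    exact hmono.injective (by omega)
  have hab : ∀ i j, a i ≠ b j := by
    intro i j h
    have h' : idx i - 1 = idx j := Fin.mk.inj h
    have hi := hlo i
    rcases lt_trichotomy i j with hij | rfl | hij
    · have := hmono hij
      omega
    · omega
    · have := add_two_le_of_lt_of_gap hmono hgap hij
      omega
  have hc : ∀ i, c (a i) ≠ c (b i) := by
    intro i
    refine (isum_ne_zero_iff u (Nat.sub_le (idx i) 1)).1 ?_
    rw [Nat.sub_add_cancel (hlo i)]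
    exact hnz i
  have key := two_mul_le_card_bichromatic c a b ha hb hab hc
  have hn' : ((n - 1 + 1 : ℕ) : ℤ) = n := by rw [Nat.sub_add_cancel (by omega)]
  rw [card_bichromatic_eq_two_mul, Fintype.card_fin, Fintype.card_fin, hn'] at key
  have hle := card_partial_sums_ne_le_nzIntervals u
  zify at hle
  push_cast at key
  exact (le_of_mul_le_mul_left key two_pos).trans hle
end

section
/- Let n ≥ 3 and q ≥ 2 be integers, and let y be an (n−1)×(n−1) matrix over ℤ/qℤ. Suppose i_1 < i_2 < ⋯ < i_k are row indices in {1,…,n−1} with i_{m+1} ≥ i_m + 2 for every 1 ≤ m ≤ k−1, and let S_m denote the number of nonzero intervals of the i_m-th row of y. Then N(y) ≥ S_1·(n−1) + S_2·(n−3) + ⋯ + S_k·(n−2k+1). -/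
/-- For a pseudometric `d` and disjoint pairs `{a m, a m + 1}` in `V`, the total distance over `V`
dominates a weighted sum of the distances of the pairs. -/
theorem sum_weighted_pair_dist_le (d : ℕ → ℕ → ℤ) (hself : ∀ x, d x x = 0)
    (hcomm : ∀ x y, d x y = d y x) (htri : ∀ x y z, d x z ≤ d x y + d y z) (k : ℕ) :
    ∀ (V : Finset ℕ) (a : Fin k → ℕ), (∀ m, a m ∈ V) → (∀ m, a m + 1 ∈ V) →
      (∀ m m', m < m' → a m + 2 ≤ a m') →
      2 * ∑ m, d (a m) (a m + 1) * ((V.card : ℤ) - 2 * ((m : ℕ) : ℤ) - 1) ≤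
        ∑ x ∈ V, ∑ y ∈ V, d x y := by
  induction k with
  | zero =>
    intro V a _ _ _
    simp only [Finset.univ_eq_empty, Finset.sum_empty, mul_zero]
    refine Finset.sum_nonneg fun x _ => Finset.sum_nonneg fun y _ => ?_
    have h := htri x y x
    rw [hself, hcomm y x] at h
    omega
  | succ k ih =>
    intro V a h₁ h₂ hgap
    set W := (V.erase (a 0)).erase (a 0 + 1) with hW
    have hb : a 0 + 1 ∈ V.erase (a 0) := Finset.mem_erase.2 ⟨by omega, h₂ 0⟩
    have split : ∀ f : ℕ → ℤ, ∑ x ∈ V, f x = f (a 0) + f (a 0 + 1) + ∑ x ∈ W, f x := by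
      intro f
      rw [← Finset.add_sum_erase V f (h₁ 0), ← Finset.add_sum_erase _ f hb, add_assoc]
    have hcard : (V.card : ℤ) = W.card + 2 := by
      have h := split fun _ => 1
      simp only [Finset.sum_const, nsmul_eq_mul, mul_one] at h
      omega
    have hrec := ih W (fun m => a m.succ)
      (fun m => by
        have := hgap 0 m.succ (Fin.succ_pos m)
        simp only [hW, Finset.mem_erase]
        exact ⟨by omega, by omega, h₁ _⟩)
      (fun m => by
        have := hgap 0 m.succ (Fin.succ_pos m)
        simp only [hW, Finset.mem_erase]
        exact ⟨by omega, by omega, h₂ _⟩)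
      (fun m m' h => hgap _ _ (Fin.succ_lt_succ_iff.2 h))
    have hpair : (W.card : ℤ) * d (a 0) (a 0 + 1) ≤
        ∑ x ∈ W, d (a 0) x + ∑ x ∈ W, d (a 0 + 1) x := by
      rw [← Finset.sum_add_distrib, ← nsmul_eq_mul]
      refine Finset.card_nsmul_le_sum _ _ _ fun x _ => ?_
      rw [hcomm (a 0 + 1) x]
      exact htri _ _ _
    have hsum : ∑ x ∈ V, ∑ y ∈ V, d x y =
        2 * d (a 0) (a 0 + 1) + 2 * (∑ x ∈ W, d (a 0) x + ∑ x ∈ W, d (a 0 + 1) x) +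
          ∑ x ∈ W, ∑ y ∈ W, d x y := by
      have hrow : ∀ z, ∑ x ∈ W, d x z = ∑ x ∈ W, d z x := fun z =>
        Finset.sum_congr rfl fun x _ => hcomm x z
      simp only [split, Finset.sum_add_distrib, hself, hrow (a 0), hrow (a 0 + 1)]
      rw [hcomm (a 0 + 1) (a 0)]
      ring
    rw [Fin.sum_univ_succ, hsum, hcard]
    have htail : ∀ m : Fin k, ((W.card : ℤ) + 2 - 2 * ((m.succ : ℕ) : ℤ) - 1) =
        (W.card : ℤ) - 2 * ((m : ℕ) : ℤ) - 1 := fun m => by push_cast [Fin.val_succ]; ring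
    simp only [htail, Fin.val_zero]
    push_cast
    linarith

/-- A symmetric function vanishing on the diagonal sums to twice its sum over increasing pairs. -/
theorem sum_range_succ_eq_two_mul_sum_lt (d : ℕ → ℕ → ℤ) (hself : ∀ x, d x x = 0)
    (hcomm : ∀ x y, d x y = d y x) (m : ℕ) :
    ∑ x ∈ Finset.range (m + 1), ∑ y ∈ Finset.range (m + 1), d x y =
      2 * ∑ i ∈ Finset.range m, ∑ j ∈ Finset.range m, if i ≤ j then d i (j + 1) else 0 := by
  induction m with
  | zero => simp [hself]
  | succ m ih =>
    have hlast : ∑ j ∈ Finset.range m, (if m ≤ j then d m (j + 1) else 0) = 0 :=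
      Finset.sum_eq_zero fun j hj => if_neg (by have := Finset.mem_range.1 hj; omega)
    have hcol : ∑ i ∈ Finset.range m, (if i ≤ m then d i (m + 1) else 0) =
        ∑ i ∈ Finset.range m, d i (m + 1) :=
      Finset.sum_congr rfl fun i hi => if_pos (Finset.mem_range.1 hi).le
    have hL : ∑ x ∈ Finset.range (m + 1 + 1), ∑ y ∈ Finset.range (m + 1 + 1), d x y =
        ∑ x ∈ Finset.range (m + 1), ∑ y ∈ Finset.range (m + 1), d x y +
          2 * ∑ x ∈ Finset.range (m + 1), d x (m + 1) := by
      simp only [Finset.sum_range_succ _ (m + 1), Finset.sum_add_distrib, hself,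
        hcomm (m + 1) _]
      ring
    have hR : (∑ i ∈ Finset.range (m + 1), ∑ j ∈ Finset.range (m + 1),
          if i ≤ j then d i (j + 1) else 0) =
        (∑ i ∈ Finset.range m, ∑ j ∈ Finset.range m, if i ≤ j then d i (j + 1) else 0) +
          ∑ x ∈ Finset.range (m + 1), d x (m + 1) := by
      simp only [Finset.sum_range_succ _ m, Finset.sum_add_distrib, hlast, hcol, le_refl, if_true]
      ring
    rw [hL, hR, ih]
    ring

/-- The sum of the entries of `y` over the first `x` rows and the columns in `p`. -/
def rowPrefix {m q : ℕ} (y : Matrix (Fin m) (Fin m) (ZMod q)) (x : ℕ) (p : ℕ × ℕ) : ZMod q :=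
  ∑ a ∈ Finset.univ.filter (fun a : Fin m => (a : ℕ) < x), isum (y a) p.1 p.2

/-- The number of column intervals on which two row prefixes differ. -/
def prefixDist {m q : ℕ} (y : Matrix (Fin m) (Fin m) (ZMod q)) (x z : ℕ) : ℕ :=
  ((Finset.Icc 1 m ×ˢ Finset.Icc 1 m).filter
    (fun p => p.1 ≤ p.2 ∧ rowPrefix y x p ≠ rowPrefix y z p)).card

theorem prefixDist_self {m q : ℕ} (y : Matrix (Fin m) (Fin m) (ZMod q)) (x : ℕ) :
    prefixDist y x x = 0 := by
  simp [prefixDist]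

theorem prefixDist_comm {m q : ℕ} (y : Matrix (Fin m) (Fin m) (ZMod q)) (x z : ℕ) :
    prefixDist y x z = prefixDist y z x := by
  simp only [prefixDist, ne_comm]

theorem prefixDist_triangle {m q : ℕ} (y : Matrix (Fin m) (Fin m) (ZMod q)) (x z w : ℕ) :
    prefixDist y x w ≤ prefixDist y x z + prefixDist y z w := by
  refine (Finset.card_le_card fun p hp => ?_).trans (Finset.card_union_le _ _)
  simp only [Finset.mem_union, Finset.mem_filter] at hp ⊢
  by_cases h : rowPrefix y x p = rowPrefix y z p
  · exact Or.inr ⟨hp.1, hp.2.1, h ▸ hp.2.2⟩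
  · exact Or.inl ⟨hp.1, hp.2.1, h⟩

theorem rowPrefix_add_bsum {m q : ℕ} (y : Matrix (Fin m) (Fin m) (ZMod q)) {i j : ℕ}
    (hij : i ≤ j) (p : ℕ × ℕ) :
    rowPrefix y i p + bsum y (i + 1) (j + 1) p.1 p.2 = rowPrefix y (j + 1) p := by
  have hdisj : Disjoint (Finset.univ.filter fun a : Fin m => (a : ℕ) < i)
      (Finset.univ.filter fun a : Fin m => i + 1 ≤ (a : ℕ) + 1 ∧ (a : ℕ) + 1 ≤ j + 1) :=
    Finset.disjoint_filter.2 fun a _ h => by omega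
  change _ + ∑ a ∈ _, isum (y a) p.1 p.2 = _
  rw [rowPrefix, rowPrefix, ← Finset.sum_union hdisj, ← Finset.filter_or]
  congr 1
  ext a
  simp only [Finset.mem_filter, Finset.mem_univ, true_and]
  omega

theorem bsum_single_row {m q : ℕ} (y : Matrix (Fin m) (Fin m) (ZMod q)) (a : Fin m) (k l : ℕ) :
    bsum y (a + 1) (a + 1) k l = isum (y a) k l := by
  have h : (Finset.univ.filter fun b : Fin m =>
      (a : ℕ) + 1 ≤ (b : ℕ) + 1 ∧ (b : ℕ) + 1 ≤ (a : ℕ) + 1) = {a} := by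
    ext b
    simp only [Finset.mem_filter, Finset.mem_univ, true_and, Finset.mem_singleton, Fin.ext_iff]
    omega
  rw [bsum, h, Finset.sum_singleton, isum]

theorem prefixDist_eq_card_bsum {m q : ℕ} (y : Matrix (Fin m) (Fin m) (ZMod q)) {i j : ℕ}
    (hij : i ≤ j) :
    prefixDist y i (j + 1) = ((Finset.Icc 1 m ×ˢ Finset.Icc 1 m).filter
      (fun p => p.1 ≤ p.2 ∧ bsum y (i + 1) (j + 1) p.1 p.2 ≠ 0)).card := by
  simp only [prefixDist, ← rowPrefix_add_bsum y hij, ne_eq, left_eq_add]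

theorem prefixDist_succ {m q : ℕ} (y : Matrix (Fin m) (Fin m) (ZMod q)) (a : Fin m) :
    prefixDist y a (a + 1) = nzIntervals (y a) := by
  simp only [prefixDist_eq_card_bsum y le_rfl, bsum_single_row, nzIntervals]

theorem Nboxes_eq_sum_prefixDist {m q : ℕ} (y : Matrix (Fin m) (Fin m) (ZMod q)) :
    Nboxes y = ∑ i ∈ Finset.range m, ∑ j ∈ Finset.range m,
      if i ≤ j then prefixDist y i (j + 1) else 0 := by
  have shift : ∀ f : ℕ → ℕ, ∑ i ∈ Finset.Icc 1 m, f i = ∑ i ∈ Finset.range m, f (i + 1) := by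
    intro f
    rw [Finset.range_eq_Ico, Finset.sum_Ico_add' f 0 m 1]
    rfl
  rw [Nboxes, Finset.card_filter, Finset.sum_product, Finset.sum_product, shift]
  refine Finset.sum_congr rfl fun i _ => ?_
  rw [shift]
  refine Finset.sum_congr rfl fun j _ => ?_
  split_ifs with hij
  · rw [prefixDist_eq_card_bsum y hij, Finset.card_filter]
    simp only [Nat.succ_le_succ hij, true_and]
  · refine Finset.sum_eq_zero fun p _ => if_neg fun h => hij ?_
    exact Nat.le_of_succ_le_succ h.1

theorem stmt12 (n q : ℕ) (hn : 3 ≤ n) (hq : 2 ≤ q)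
    (y : Matrix (Fin (n - 1)) (Fin (n - 1)) (ZMod q))
    (k : ℕ) (idx : Fin k → Fin (n - 1))
    (hmono : StrictMono idx)
    (hgap : ∀ m : Fin k, ∀ hm : (m : ℕ) + 1 < k,
        (idx m : ℕ) + 2 ≤ (idx ⟨(m : ℕ) + 1, hm⟩ : ℕ)) :
    ∑ m : Fin k, (nzIntervals (y (idx m)) : ℤ) * ((n : ℤ) - 2 * ((m : ℕ) : ℤ) - 1)
      ≤ (Nboxes y : ℤ) := by
  have hself : ∀ x, (prefixDist y x x : ℤ) = 0 := fun x => by rw [prefixDist_self]; rfl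
  have hcomm : ∀ x z, (prefixDist y x z : ℤ) = prefixDist y z x := fun x z => by
    rw [prefixDist_comm]
  have key := sum_weighted_pair_dist_le (fun x z => (prefixDist y x z : ℤ)) hself hcomm
    (fun x z w => by exact_mod_cast prefixDist_triangle y x z w) k
    (Finset.range (n - 1 + 1)) (fun m => idx m)
    (fun m => Finset.mem_range.2 (by omega)) (fun m => Finset.mem_range.2 (by omega))
    (fun m m' h => by
      have hlt : (m : ℕ) + 1 < k := by omega
      have hle : idx ⟨(m : ℕ) + 1, hlt⟩ ≤ idx m' := hmono.monotone (Fin.mk_le_of_le_val h)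
      exact (hgap m hlt).trans hle)
  rw [sum_range_succ_eq_two_mul_sum_lt _ hself hcomm, Finset.card_range,
    Nat.sub_add_cancel (by omega)] at key
  rw [Nboxes_eq_sum_prefixDist]
  simp only [prefixDist_succ] at key
  push_cast
  linarith
end

section
/- Let n ≥ 3 and q ≥ 2 be integers, let ε be a real number with 0 < ε ≤ 1/80, and let w be an integer with 1 ≤ w ≤ ε·n. Then the number of (n−1)×(n−1) matrices y over ℤ/qℤ with N(y) ≤ (w + 1/2)·n² is at most q^{32w}·n^{2w + 1 + 60εw}. -/
/-- The alternating sum of `g` over the four corners of the box with sides `[i,j]` and `[k,l]`. -/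
def cornerSum {ι A : Type*} [AddCommGroup A] (g : ι × ι → A) (i j k l : ι) : A :=
  g (j, l) - g (i, l) - (g (j, k) - g (i, k))

/-- The mixed second difference of `g`. -/
def mixedDiff {m : ℕ} {A : Type*} [AddCommGroup A] (g : Fin (m + 1) × Fin (m + 1) → A) :
    Matrix (Fin m) (Fin m) A :=
  fun a c => cornerSum g a.castSucc a.succ c.castSucc c.succ

/-- Ordered quadruples of indices on which the alternating corner sum of `g` does not vanish. -/
def nonzeroCorners {ι A : Type*} [Fintype ι] [AddCommGroup A] [DecidableEq A] (g : ι × ι → A) :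
    Finset ((ι × ι) × (ι × ι)) :=
  Finset.univ.filter fun p => cornerSum g p.1.1 p.1.2 p.2.1 p.2.2 ≠ 0

theorem sum_filter_succ_sub_castSucc {m : ℕ} {A : Type*} [AddCommGroup A] (h : Fin (m + 1) → A)
    (i j : Fin (m + 1)) (hij : i ≤ j) :
    ∑ a ∈ Finset.univ.filter
        (fun a : Fin m => (i : ℕ) + 1 ≤ (a : ℕ) + 1 ∧ (a : ℕ) + 1 ≤ (j : ℕ)),
      (h a.succ - h a.castSucc) = h j - h i := by
  induction j using Fin.induction with
  | zero =>
    obtain rfl : i = 0 := Fin.le_zero_iff.mp hij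
    simp
  | succ j ih =>
    rcases hij.eq_or_lt with rfl | hlt
    · rw [Finset.filter_false_of_mem, Finset.sum_empty, sub_self]
      rintro a - ⟨h1, h2⟩
      omega
    · have hi : i ≤ j.castSucc := Fin.le_castSucc_iff.mpr hlt
      have hset : Finset.univ.filter
            (fun a : Fin m => (i : ℕ) + 1 ≤ (a : ℕ) + 1 ∧ (a : ℕ) + 1 ≤ (j.succ : ℕ)) =
          insert j (Finset.univ.filter
            (fun a : Fin m => (i : ℕ) + 1 ≤ (a : ℕ) + 1 ∧ (a : ℕ) + 1 ≤ (j.castSucc : ℕ))) := by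
        ext a
        have hi' : (i : ℕ) ≤ j := hi
        simp only [Finset.mem_filter, Finset.mem_univ, true_and, Finset.mem_insert, Fin.ext_iff,
          Fin.val_succ, Fin.val_castSucc]
        omega
      rw [hset, Finset.sum_insert (by simp), ih hi]
      abel

theorem bsum_mixedDiff {m q : ℕ} (g : Fin (m + 1) × Fin (m + 1) → ZMod q)
    (i j k l : Fin (m + 1)) (hij : i ≤ j) (hkl : k ≤ l) :
    bsum (mixedDiff g) (i + 1) j (k + 1) l = cornerSum g i j k l := by
  unfold bsum mixedDiff cornerSum
  have hrow (a : Fin m) := sum_filter_succ_sub_castSucc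
    (fun c => g (a.succ, c) - g (a.castSucc, c)) k l hkl
  simp only [hrow]
  have := sum_filter_succ_sub_castSucc (fun a => g (a, l) - g (a, k)) i j hij
  rw [show g (j, l) - g (i, l) - (g (j, k) - g (i, k)) =
    g (j, l) - g (j, k) - (g (i, l) - g (i, k)) by abel, ← this]
  exact Finset.sum_congr rfl fun a _ => by abel

theorem exists_mixedDiff_eq {m q : ℕ} (y : Matrix (Fin m) (Fin m) (ZMod q)) :
    ∃ g : Fin (m + 1) × Fin (m + 1) → ZMod q, mixedDiff g = y := by
  have hfilter (b : Fin m) : Finset.univ.filter (fun a : Fin m => (a : ℕ) < b + 1) =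
      insert b (Finset.univ.filter (fun a : Fin m => (a : ℕ) < b)) := by
    ext a
    simp only [Finset.mem_filter, Finset.mem_univ, true_and, Finset.mem_insert, Fin.ext_iff]
    omega
  have hsum (f : Fin m → ZMod q) (b : Fin m) :
      ∑ a ∈ Finset.univ.filter (fun a : Fin m => (a : ℕ) < b + 1), f a =
        f b + ∑ a ∈ Finset.univ.filter (fun a : Fin m => (a : ℕ) < b), f a := by
    rw [hfilter, Finset.sum_insert (by simp)]
  refine ⟨fun p => ∑ a ∈ Finset.univ.filter (fun a : Fin m => (a : ℕ) < p.1),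
    ∑ c ∈ Finset.univ.filter (fun c : Fin m => (c : ℕ) < p.2), y a c, ?_⟩
  ext a c
  simp only [mixedDiff, cornerSum, Fin.val_succ, Fin.val_castSucc, hsum, Finset.sum_add_distrib]
  abel

theorem card_nonzeroCorners_le {m q : ℕ} (g : Fin (m + 1) × Fin (m + 1) → ZMod q) :
    (nonzeroCorners g).card ≤ 4 * Nboxes (mixedDiff g) := by
  unfold Nboxes
  refine Finset.card_le_mul_card_image_of_maps_to
    (f := fun p : (Fin (m + 1) × Fin (m + 1)) × (Fin (m + 1) × Fin (m + 1)) =>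
      ((((min p.1.1 p.1.2 : Fin (m + 1)) : ℕ) + 1, ((max p.1.1 p.1.2 : Fin (m + 1)) : ℕ)),
      (((min p.2.1 p.2.2 : Fin (m + 1)) : ℕ) + 1, ((max p.2.1 p.2.2 : Fin (m + 1)) : ℕ)))) ?_ 4 ?_
  · rintro ⟨⟨i, j⟩, ⟨k, l⟩⟩ hp
    simp only [nonzeroCorners, Finset.mem_filter, Finset.mem_univ, true_and] at hp
    have hij : i ≠ j := by
      rintro rfl
      simp [cornerSum] at hp
    have hkl : k ≠ l := by
      rintro rfl
      simp [cornerSum] at hp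
    have hbox : cornerSum g (min i j) (max i j) (min k l) (max k l) ≠ 0 := by
      rcases le_total i j with h | h <;> rcases le_total k l with h' | h' <;>
        simp only [h, h', min_eq_left, min_eq_right, max_eq_left, max_eq_right] <;>
        intro h0 <;> apply hp <;> unfold cornerSum at h0 ⊢
      · exact h0
      · rw [← neg_eq_zero, ← h0]; abel
      · rw [← neg_eq_zero, ← h0]; abel
      · rw [← h0]; abel
    have h1 : min i j < max i j := min_lt_max.mpr hij
    have h2 : min k l < max k l := min_lt_max.mpr hkl
    have h1' : ((min i j : Fin (m + 1)) : ℕ) < (max i j : Fin (m + 1)) := h1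
    have h2' : ((min k l : Fin (m + 1)) : ℕ) < (max k l : Fin (m + 1)) := h2
    simp only [Finset.mem_filter, Finset.mem_product, Finset.mem_Icc,
      bsum_mixedDiff g _ _ _ _ h1.le h2.le]
    refine ⟨?_, by omega, by omega, hbox⟩
    have := (max i j).isLt
    have := (max k l).isLt
    omega
  · intro b _
    refine (Finset.card_le_card_of_injOn (t := (Finset.univ : Finset (Bool × Bool)))
      (fun p => (decide (p.1.1 < p.1.2), decide (p.2.1 < p.2.2))) (fun _ _ => Finset.mem_univ _)
      ?_).trans_eq (by simp)
    rintro ⟨⟨i, j⟩, ⟨k, l⟩⟩ hp ⟨⟨i', j'⟩, ⟨k', l'⟩⟩ hp' heq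
    simp only [Finset.coe_filter, Set.mem_ofPred_eq] at hp hp'
    have h := hp.2.trans hp'.2.symm
    simp only [Prod.mk.injEq, decide_eq_decide, Fin.lt_def, Fin.coe_min, Fin.coe_max,
      Fin.ext_iff] at heq h ⊢
    omega

/-- Subtracting a suitable row and a suitable value in each row makes `g` sparse, without changing
its alternating corner sums. -/
theorem exists_sparse_of_nonzeroCorners {n : ℕ} (hn : 0 < n) {A : Type*} [AddCommGroup A]
    [DecidableEq A] (g : Fin n × Fin n → A) :
    ∃ f : Fin n × Fin n → A, cornerSum f = cornerSum g ∧
      (Finset.univ.filter fun p => f p ≠ 0).card * n ^ 2 ≤ (nonzeroCorners g).card := by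
  have : NeZero n := ⟨hn.ne'⟩
  have average (F : Fin n → ℕ) : ∃ i, F i * n ≤ ∑ j, F j := by
    obtain ⟨i, -, hi⟩ := Finset.exists_min_image Finset.univ F Finset.univ_nonempty
    refine ⟨i, ?_⟩
    simpa [mul_comm] using Finset.card_nsmul_le_sum Finset.univ F (F i) hi
  let E (i j k l : Fin n) : ℕ := if cornerSum g i j k l ≠ 0 then 1 else 0
  have hcount : (nonzeroCorners g).card = ∑ i, ∑ j, ∑ k, ∑ l, E i j k l := by
    rw [nonzeroCorners, Finset.card_filter, Fintype.sum_prod_type, Fintype.sum_prod_type]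
    simp only [Fintype.sum_prod_type, E]
  obtain ⟨i, hi⟩ := average fun i => ∑ j, ∑ k, ∑ l, E i j k l
  choose k hk using fun j => average fun k => ∑ l, E i j k l
  refine ⟨fun p => cornerSum g i p.1 (k p.1) p.2, ?_, ?_⟩
  · funext a b c d
    simp only [cornerSum]
    abel
  · rw [hcount, Finset.card_filter, Fintype.sum_prod_type]
    calc _ = (∑ j, (∑ l, E i j (k j) l) * n) * n := by
          rw [← Finset.sum_mul]; ring
      _ ≤ (∑ j, ∑ k, ∑ l, E i j k l) * n := by gcongr with j; exact hk j
      _ ≤ _ := hi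

theorem card_support_mul_sq_le {n : ℕ} {A : Type*} [AddCommGroup A] [DecidableEq A]
    (g : Fin n × Fin n → A) :
    4 * ((Finset.univ.filter fun p => g p ≠ 0).card *
        (n - (Finset.univ.filter fun p => g p ≠ 0).card) ^ 2) ≤ (nonzeroCorners g).card := by
  classical
  set s := Finset.univ.filter fun p => g p ≠ 0 with hs
  let e (i k : Fin n) : ℕ := if g (i, k) ≠ 0 then 1 else 0
  let r (j : Fin n) : ℕ := if ∀ k, g (j, k) = 0 then 1 else 0
  let c (l : Fin n) : ℕ := if ∀ i, g (i, l) = 0 then 1 else 0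
  have he : ∑ i, ∑ k, e i k = s.card := by
    rw [hs, Finset.card_filter, Fintype.sum_prod_type]
  have hr : n - s.card ≤ ∑ j, r j := by
    have h1 : ((s.image Prod.fst)ᶜ).card ≤ ∑ j, r j := by
      rw [← Finset.card_filter]
      refine Finset.card_le_card fun j hj => ?_
      simpa [hs] using hj
    have h2 : (s.image Prod.fst).card ≤ s.card := Finset.card_image_le
    rw [Finset.card_compl, Fintype.card_fin] at h1
    omega
  have hc : n - s.card ≤ ∑ l, c l := by
    have h1 : ((s.image Prod.snd)ᶜ).card ≤ ∑ l, c l := by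
      rw [← Finset.card_filter]
      refine Finset.card_le_card fun j hj => ?_
      simpa [hs] using hj
    have h2 : (s.image Prod.snd).card ≤ s.card := Finset.card_image_le
    rw [Finset.card_compl, Fintype.card_fin] at h1
    omega
  have hpoint (i j k l : Fin n) : e i k * (r j * c l) + e j k * (r i * c l) +
      e i l * (r j * c k) + e j l * (r i * c k) ≤
        if cornerSum g i j k l ≠ 0 then 1 else 0 := by
    by_cases hi : ∀ k, g (i, k) = 0 <;> by_cases hj : ∀ k, g (j, k) = 0 <;>
    by_cases hk : ∀ i, g (i, k) = 0 <;> by_cases hl : ∀ i, g (i, l) = 0 <;>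
    simp [e, r, c, cornerSum, hi, hj, hk, hl]
  have hsum : ∑ i, ∑ j, ∑ k, ∑ l, (e i k * (r j * c l) + e j k * (r i * c l) +
      e i l * (r j * c k) + e j l * (r i * c k)) =
        4 * ((∑ i, ∑ k, e i k) * ((∑ j, r j) * ∑ l, c l)) := by
    have h1 : ∑ i, ∑ j, ∑ k, ∑ l, e i k * (r j * c l) =
        (∑ i, ∑ k, e i k) * ((∑ j, r j) * ∑ l, c l) := by
      simp only [← Finset.mul_sum, ← Finset.sum_mul]
    have h2 : ∑ i, ∑ j, ∑ k, ∑ l, e j k * (r i * c l) =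
        ∑ i, ∑ j, ∑ k, ∑ l, e i k * (r j * c l) := Finset.sum_comm
    have h3 : ∑ i, ∑ j, ∑ k, ∑ l, e i l * (r j * c k) =
        ∑ i, ∑ j, ∑ k, ∑ l, e i k * (r j * c l) :=
      Finset.sum_congr rfl fun i _ => Finset.sum_congr rfl fun j _ => Finset.sum_comm
    have h4 : ∑ i, ∑ j, ∑ k, ∑ l, e j l * (r i * c k) =
        ∑ i, ∑ j, ∑ k, ∑ l, e i k * (r j * c l) := Finset.sum_comm.trans h3
    simp only [Finset.sum_add_distrib]
    rw [h2, h3, h4, h1]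
    ring
  calc 4 * (s.card * (n - s.card) ^ 2)
      ≤ 4 * ((∑ i, ∑ k, e i k) * ((∑ j, r j) * ∑ l, c l)) := by
        rw [he, sq]; gcongr
    _ ≤ ∑ i, ∑ j, ∑ k, ∑ l, if cornerSum g i j k l ≠ 0 then 1 else 0 := by
        rw [← hsum]; gcongr; exact hpoint _ _ _ _
    _ = (nonzeroCorners g).card := by
        rw [nonzeroCorners, Finset.card_filter, Fintype.sum_prod_type, Fintype.sum_prod_type]
        simp only [Fintype.sum_prod_type]

theorem card_filter_support_le {α A : Type*} [Fintype α] [DecidableEq α] [Nonempty α]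
    [Fintype A] [Zero A] [DecidableEq A] (s : ℕ) :
    (Finset.univ.filter fun f : α → A => (Finset.univ.filter fun x => f x ≠ 0).card ≤ s).card ≤
      (Fintype.card α * Fintype.card A) ^ s := by
  induction s with
  | zero =>
    rw [pow_zero, Finset.card_le_one]
    intro f hf g hg
    simp only [Finset.mem_filter, Finset.mem_univ, true_and, Nat.le_zero, Finset.card_eq_zero,
      Finset.filter_eq_empty_iff, not_not, forall_const] at hf hg
    ext x
    rw [@hf x, @hg x]
  | succ s ih =>
    let t := Finset.univ.filter fun f : α → A => (Finset.univ.filter fun x => f x ≠ 0).card ≤ s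
    have hsub : (Finset.univ.filter fun f : α → A =>
        (Finset.univ.filter fun x => f x ≠ 0).card ≤ s + 1) ⊆
        (t ×ˢ (Finset.univ : Finset (α × A))).image fun p => Function.update p.1 p.2.1 p.2.2 := by
      intro f hf
      simp only [Finset.mem_filter, Finset.mem_univ, true_and] at hf
      simp only [Finset.mem_image, Finset.mem_product, Finset.mem_univ, and_true, t,
        Finset.mem_filter, true_and]
      rcases (Finset.univ.filter fun x => f x ≠ 0).eq_empty_or_nonempty with h | ⟨x, hx⟩
      · obtain ⟨x⟩ := ‹Nonempty α›
        exact ⟨(f, x, f x), by simp [h], by simp⟩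
      · refine ⟨(Function.update f x 0, x, f x), ?_, by simp⟩
        have : (Finset.univ.filter fun z => Function.update f x 0 z ≠ 0) =
            (Finset.univ.filter fun z => f z ≠ 0).erase x := by
          ext z
          by_cases hz : z = x <;> simp [hz]
        rw [this, Finset.card_erase_of_mem hx]
        omega
    calc _ ≤ _ := Finset.card_le_card hsub
      _ ≤ _ := Finset.card_image_le
      _ = t.card * (Fintype.card α * Fintype.card A) := by
        rw [Finset.card_product, Finset.card_univ, Fintype.card_prod]
      _ ≤ _ := by rw [pow_succ]; gcongr

theorem exists_mixedDiff_eq_of_Nboxes_le {m q w : ℕ} {ε : ℝ} (hε0 : 0 < ε) (hε1 : ε ≤ 1 / 80)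
    (hw1 : 1 ≤ w) (hw2 : (w : ℝ) ≤ ε * (m + 1 : ℕ)) (y : Matrix (Fin m) (Fin m) (ZMod q))
    (hy : (Nboxes y : ℝ) ≤ ((w : ℝ) + 1 / 2) * ((m + 1 : ℕ) : ℝ) ^ 2) :
    ∃ f : Fin (m + 1) × Fin (m + 1) → ZMod q, mixedDiff f = y ∧
      2 * ((Finset.univ.filter fun p => f p ≠ 0).card : ℝ) ≤ 2 * w + 1 + 60 * ε * w := by
  obtain ⟨g, rfl⟩ := exists_mixedDiff_eq y
  obtain ⟨f, hfg, hf⟩ := exists_sparse_of_nonzeroCorners (by omega : 0 < m + 1) g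
  refine ⟨f, by ext a c; simp only [mixedDiff, hfg], ?_⟩
  have hM := card_nonzeroCorners_le g
  have hfM := card_support_mul_sq_le f
  have hcorners : nonzeroCorners f = nonzeroCorners g := by simp only [nonzeroCorners, hfg]
  rw [hcorners] at hfM
  set s := (Finset.univ.filter fun p => f p ≠ 0).card
  have h1 := hf.trans hM
  have h2 := hfM.trans hM
  clear_value s
  generalize Nboxes (mixedDiff g) = N at h1 h2 hy
  clear hM hfM hcorners hf hfg f g
  generalize m + 1 = n at *
  have hw1' : (1 : ℝ) ≤ w := by exact_mod_cast hw1
  have hn : (0 : ℝ) < n := by nlinarith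
  have h1' : (s : ℝ) * n ^ 2 ≤ 4 * N := by exact_mod_cast h1
  have hs : (s : ℝ) ≤ 4 * w + 2 :=
    le_of_mul_le_mul_right (by linarith) (by positivity : (0 : ℝ) < (n : ℝ) ^ 2)
  have hs6 : (s : ℝ) ≤ 6 * (ε * n) := by linarith
  have hsn : s ≤ n := by
    have : (s : ℝ) ≤ n := by nlinarith
    exact_mod_cast this
  have h2' : 4 * ((s : ℝ) * ((n : ℝ) - s) ^ 2) ≤ 4 * N := by
    rw [← Nat.cast_sub hsn]
    exact_mod_cast h2
  have hsq : (n : ℝ) ^ 2 * (1 - 12 * ε) ≤ ((n : ℝ) - s) ^ 2 := by nlinarith [sq_nonneg (s : ℝ)]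
  have h3 : (s : ℝ) * (1 - 12 * ε) ≤ w + 1 / 2 := by
    refine le_of_mul_le_mul_right ?_ (by positivity : (0 : ℝ) < (n : ℝ) ^ 2)
    have := mul_le_mul_of_nonneg_left hsq (Nat.cast_nonneg (α := ℝ) s)
    linarith
  have hpos : (0 : ℝ) < 1 - 12 * ε := by linarith
  refine le_of_mul_le_mul_right ?_ hpos
  have hεw : 0 < ε * w := by positivity
  nlinarith [mul_le_mul_of_nonneg_left hε1 hεw.le, mul_le_mul_of_nonneg_left hw1' hε0.le]

theorem stmt14 (n q : ℕ) (hn : 3 ≤ n) (hq : 2 ≤ q)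
    (ε : ℝ) (hε0 : 0 < ε) (hε1 : ε ≤ 1 / 80)
    (w : ℕ) (hw1 : 1 ≤ w) (hw2 : (w : ℝ) ≤ ε * n) :
    (Set.ncard {y : Matrix (Fin (n - 1)) (Fin (n - 1)) (ZMod q) |
        (Nboxes y : ℝ) ≤ ((w : ℝ) + 1 / 2) * (n : ℝ) ^ 2} : ℝ)
      ≤ (q : ℝ) ^ (32 * (w : ℝ)) * (n : ℝ) ^ (2 * (w : ℝ) + 1 + 60 * ε * w) := by
  obtain ⟨m, rfl⟩ : ∃ m, n = m + 1 := ⟨n - 1, by omega⟩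
  change (Set.ncard {y : Matrix (Fin m) (Fin m) (ZMod q) |
    (Nboxes y : ℝ) ≤ ((w : ℝ) + 1 / 2) * ((m + 1 : ℕ) : ℝ) ^ 2} : ℝ) ≤ _
  have : NeZero q := ⟨by omega⟩
  have hw1' : (1 : ℝ) ≤ w := by exact_mod_cast hw1
  have hεw : 0 ≤ ε * w := by positivity
  have hεw' : ε * w ≤ 1 / 80 * w := by gcongr
  let s := ⌊(2 * (w : ℝ) + 1 + 60 * ε * w) / 2⌋₊
  have hs : (s : ℝ) ≤ (2 * (w : ℝ) + 1 + 60 * ε * w) / 2 := Nat.floor_le (by linarith)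
  let t := Finset.univ.filter fun f : Fin (m + 1) × Fin (m + 1) → ZMod q =>
    (Finset.univ.filter fun p => f p ≠ 0).card ≤ s
  have hsub : {y : Matrix (Fin m) (Fin m) (ZMod q) |
      (Nboxes y : ℝ) ≤ ((w : ℝ) + 1 / 2) * ((m + 1 : ℕ) : ℝ) ^ 2} ⊆ mixedDiff '' (t : Set _) := by
    intro y hy
    obtain ⟨f, hf, hcard⟩ := exists_mixedDiff_eq_of_Nboxes_le hε0 hε1 hw1 hw2 y hy
    refine ⟨f, ?_, hf⟩
    simp only [t, Finset.coe_filter, Finset.mem_univ, true_and, Set.mem_ofPred_eq]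
    exact Nat.le_floor (by linarith)
  have hncard := (Set.ncard_le_ncard hsub (Set.toFinite _)).trans (Set.ncard_image_le t.finite_toSet)
  rw [Set.ncard_coe_finset] at hncard
  have hcard := hncard.trans (card_filter_support_le s)
  rw [Fintype.card_prod, Fintype.card_fin, ZMod.card] at hcard
  have hq1 : (1 : ℝ) ≤ q := by exact_mod_cast (by omega : 1 ≤ q)
  have hn1 : (1 : ℝ) ≤ (m + 1 : ℕ) := by exact_mod_cast (by omega : 1 ≤ m + 1)
  refine (Nat.cast_le.mpr hcard).trans ?_
  generalize m + 1 = n at hn1 ⊢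
  calc
    (((n * n * q) ^ s : ℕ) : ℝ) = (q : ℝ) ^ (s : ℝ) * (n : ℝ) ^ (2 * s : ℝ) := by
      rw [Real.rpow_natCast, show (2 * s : ℝ) = ((2 * s : ℕ) : ℝ) by push_cast; rfl,
        Real.rpow_natCast]
      push_cast
      ring
    _ ≤ _ := by
      gcongr <;> linarith
end
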